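/- Let f be a log-concave probability density on ℝ^d that attains its maximum value M = max_{x ∈ ℝ^d} f(x) at some point, and let δ ∈ (0, 1/e]. Then ∫₀^{δ·M} vol({x ∈ ℝ^d : f(x) ≥ y}) dy ≤ 2e·2^d·d!·√δ. -/

import Mathlib

open MeasureTheory

/-- A probability density function on ℝ^d. -/
def IsDensity {d : ℕ} (f : EuclideanSpace ℝ (Fin d) → ℝ) : Prop :=
  Measurable f ∧ (∀ x, 0 ≤ f x) ∧ (∫ x, f x) = 1

/-- A log-concave density: a density of the form `f = exp φ` for an upper
semicontinuous concave function `φ : ℝ^d → [-∞, ∞)`. -/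
def IsLogConcaveDensity {d : ℕ} (f : EuclideanSpace ℝ (Fin d) → ℝ) : Prop :=
  IsDensity f ∧
  ∃ φ : EuclideanSpace ℝ (Fin d) → EReal,
    UpperSemicontinuous φ ∧ (∀ x, φ x ≠ ⊤) ∧
    (∀ x y : EuclideanSpace ℝ (Fin d), ∀ t : ℝ, 0 ≤ t → t ≤ 1 →
      (t : EReal) * φ x + ((1 - t : ℝ) : EReal) * φ y ≤ φ (t • x + (1 - t) • y)) ∧
    (∀ x, f x = if φ x = ⊥ then 0 else Real.exp (φ x).toReal)

/-- The multiplicative form of log-concavity, on the set where the density is positive. -/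
theorem IsLogConcaveDensity.exp_le {d : ℕ} {f : EuclideanSpace ℝ (Fin d) → ℝ}
    (hf : IsLogConcaveDensity f) {x y : EuclideanSpace ℝ (Fin d)} (hx : 0 < f x) (hy : 0 < f y)
    {t : ℝ} (ht0 : 0 ≤ t) (ht1 : t ≤ 1) :
    Real.exp (t * Real.log (f x) + (1 - t) * Real.log (f y)) ≤ f (t • x + (1 - t) • y) := by
  obtain ⟨-, φ, -, htop, hconc, hφ⟩ := hf
  have hval : ∀ z, 0 < f z → φ z = (Real.log (f z) : EReal) := by
    intro z hz
    have hbot : φ z ≠ ⊥ := by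
      intro h
      simp [hφ z, h] at hz
    rw [hφ z, if_neg hbot, Real.log_exp, EReal.coe_toReal (htop z) hbot]
  have h := hconc x y t ht0 ht1
  rw [hval x hx, hval y hy] at h
  norm_cast at h
  have hbot : φ (t • x + (1 - t) • y) ≠ ⊥ := fun hb ↦
    EReal.coe_ne_bot _ (le_bot_iff.1 (hb ▸ h))
  rw [hφ (t • x + (1 - t) • y), if_neg hbot, Real.exp_le_exp]
  rwa [← EReal.coe_toReal (htop _) hbot, EReal.coe_le_coe_iff] at h

theorem IsDensity.integrable {d : ℕ} {f : EuclideanSpace ℝ (Fin d) → ℝ} (hf : IsDensity f) :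
    Integrable f :=
  Integrable.of_integral_ne_zero (by rw [hf.2.2]; exact one_ne_zero)

theorem IsDensity.pos_of_isMax {d : ℕ} {f : EuclideanSpace ℝ (Fin d) → ℝ} (hf : IsDensity f)
    {x₀ : EuclideanSpace ℝ (Fin d)} (hmax : ∀ x, f x ≤ f x₀) : 0 < f x₀ := by
  refine lt_of_le_of_ne (hf.2.1 x₀) fun h ↦ ?_
  have hzero : f = fun _ ↦ 0 := funext fun x ↦ le_antisymm (h ▸ hmax x) (hf.2.1 x)
  have h1 := hf.2.2
  simp [hzero] at h1

/-- A superlevel set at a level `y ≤ M / e` is contained in the dilation about the mode, with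
ratio `log (M / y)`, of the superlevel set at level `M / e`. -/
theorem IsLogConcaveDensity.superlevel_subset_homothety {d : ℕ}
    {f : EuclideanSpace ℝ (Fin d) → ℝ} (hf : IsLogConcaveDensity f)
    {x₀ : EuclideanSpace ℝ (Fin d)} (hM : 0 < f x₀) {y : ℝ} (hy : 0 < y)
    (hlog : 1 ≤ Real.log (f x₀ / y)) :
    {x | y ≤ f x} ⊆
      AffineMap.homothety x₀ (Real.log (f x₀ / y)) '' {x | f x₀ / Real.exp 1 ≤ f x} := by
  intro x hx
  have hx' : y ≤ f x := hx
  set τ := Real.log (f x₀ / y) with hτ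
  have hτ0 : 0 < τ := by linarith
  refine ⟨τ⁻¹ • x + (1 - τ⁻¹) • x₀, ?_, ?_⟩
  · have h := hf.exp_le (hy.trans_le hx') hM (inv_nonneg.2 hτ0.le) (inv_le_one_of_one_le₀ hlog)
    refine le_trans ?_ h
    rw [show f x₀ / Real.exp 1 = Real.exp (Real.log (f x₀) - 1) by
      rw [Real.exp_sub, Real.exp_log hM], Real.exp_le_exp]
    have hlx : Real.log y ≤ Real.log (f x) := Real.log_le_log hy hx'
    have hτ' : τ = Real.log (f x₀) - Real.log y := by rw [hτ, Real.log_div hM.ne' hy.ne']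
    have hdiff : τ⁻¹ * (Real.log (f x₀) - Real.log (f x)) ≤ τ⁻¹ * τ := by
      gcongr
      linarith
    rw [inv_mul_cancel₀ hτ0.ne'] at hdiff
    linarith
  · rw [AffineMap.homothety_apply, vsub_eq_sub, vadd_eq_add]
    rw [show τ⁻¹ • x + (1 - τ⁻¹) • x₀ - x₀ = τ⁻¹ • (x - x₀) by module, smul_smul,
      mul_inv_cancel₀ hτ0.ne']
    module

/-- The volume of a low superlevel set grows at most like a power of the logarithm. -/
theorem IsLogConcaveDensity.volume_superlevel_le {d : ℕ}
    {f : EuclideanSpace ℝ (Fin d) → ℝ} (hf : IsLogConcaveDensity f)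
    {x₀ : EuclideanSpace ℝ (Fin d)} (hM : 0 < f x₀) {y : ℝ} (hy : 0 < y)
    (hlog : 1 ≤ Real.log (f x₀ / y)) :
    (volume {x | y ≤ f x}).toReal ≤ Real.log (f x₀ / y) ^ d * (Real.exp 1 / f x₀) := by
  have hε : 0 < f x₀ / Real.exp 1 := by positivity
  have hmarkov : (volume {x | f x₀ / Real.exp 1 ≤ f x}).toReal ≤ Real.exp 1 / f x₀ := by
    have h := mul_meas_ge_le_integral_of_nonneg (μ := volume)
      (Filter.Eventually.of_forall hf.1.2.1) hf.1.integrable (f x₀ / Real.exp 1)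
    rw [hf.1.2.2, mul_comm, ← le_div_iff₀ hε, one_div_div] at h
    exact h
  have hfin : volume {x | f x₀ / Real.exp 1 ≤ f x} ≠ ⊤ :=
    (hf.1.integrable.measure_ge_lt_top hε).ne
  have hpow : 0 ≤ Real.log (f x₀ / y) ^ d := pow_nonneg (by linarith) d
  have hle := measure_mono (μ := volume) (hf.superlevel_subset_homothety hM hy hlog)
  rw [Measure.addHaar_image_homothety, finrank_euclideanSpace_fin, abs_of_nonneg hpow] at hle
  have h := ENNReal.toReal_mono (ENNReal.mul_ne_top ENNReal.ofReal_ne_top hfin) hle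
  rw [ENNReal.toReal_mul, ENNReal.toReal_ofReal hpow] at h
  exact h.trans (by gcongr)

theorem log_pow_le_two_pow_mul_factorial_mul_sqrt {u : ℝ} (hu : 1 ≤ u) (d : ℕ) :
    Real.log u ^ d ≤ 2 ^ d * d.factorial * Real.sqrt u := by
  have h := Real.pow_div_factorial_le_exp (Real.log u / 2)
    (div_nonneg (Real.log_nonneg hu) two_pos.le) d
  rw [div_pow, ← Real.log_sqrt (by linarith), Real.exp_log (Real.sqrt_pos.2 (by linarith)),
    div_div, div_le_iff₀ (by positivity)] at h
  linarith

/-- For a log-concave density `f` on ℝ^d with maximum `M = f x₀`, and `δ ∈ (0, 1/e]`,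
the mass of the low superlevel sets is small:
`∫₀^{δM} vol({f ≥ y}) dy ≤ 2e·2^d·d!·√δ`. -/
theorem low_levels_mass_bound {d : ℕ} (f : EuclideanSpace ℝ (Fin d) → ℝ)
    (hf : IsLogConcaveDensity f) (x₀ : EuclideanSpace ℝ (Fin d))
    (hmax : ∀ x, f x ≤ f x₀) (δ : ℝ) (hδ0 : 0 < δ) (hδ1 : δ ≤ 1 / Real.exp 1) :
    (∫ y in (0 : ℝ)..(δ * f x₀), (volume {x | y ≤ f x}).toReal) ≤
      2 * Real.exp 1 * 2 ^ d * (d.factorial : ℝ) * Real.sqrt δ := by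
  have hM := hf.1.pos_of_isMax hmax
  set M := f x₀ with hMdef
  set C : ℝ := 2 ^ d * (d.factorial : ℝ) with hC
  have hCpos : 0 < C := by positivity
  have hδM : 0 ≤ δ * M := by positivity
  by_cases hint : IntervalIntegrable (fun y ↦ (volume {x | y ≤ f x}).toReal) volume 0 (δ * M)
  swap
  · rw [intervalIntegral.integral_undef hint]
    positivity
  have hpt : ∀ y ∈ Set.Ioo 0 (δ * M), (volume {x | y ≤ f x}).toReal ≤
      C * Real.exp 1 / Real.sqrt M * y ^ (-(1 / 2) : ℝ) := by
    rintro y ⟨hy, hy'⟩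
    have hexp : Real.exp 1 ≤ M / y := by
      rw [le_div_iff₀ hy]
      calc Real.exp 1 * y ≤ Real.exp 1 * (1 / Real.exp 1 * M) := by
            gcongr
            exact hy'.le.trans (by gcongr)
        _ = M := by field_simp
    have hone : 1 ≤ M / y := (Real.one_le_exp zero_le_one).trans hexp
    have hlog : 1 ≤ Real.log (M / y) := (Real.le_log_iff_exp_le (by positivity)).2 hexp
    calc (volume {x | y ≤ f x}).toReal ≤ Real.log (M / y) ^ d * (Real.exp 1 / M) :=
          hf.volume_superlevel_le hM hy hlog
      _ ≤ C * Real.sqrt (M / y) * (Real.exp 1 / M) := by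
          gcongr
          exact log_pow_le_two_pow_mul_factorial_mul_sqrt hone d
      _ = C * Real.exp 1 / Real.sqrt M * y ^ (-(1 / 2) : ℝ) := by
          rw [Real.rpow_neg hy.le, ← Real.sqrt_eq_rpow, Real.sqrt_div hM.le]
          have hs : Real.sqrt M ^ 2 = M := Real.sq_sqrt hM.le
          have hs0 : 0 < Real.sqrt M := Real.sqrt_pos.2 hM
          have hy0 : 0 < Real.sqrt y := Real.sqrt_pos.2 hy
          field_simp
          rw [hs]
  calc (∫ y in (0 : ℝ)..(δ * M), (volume {x | y ≤ f x}).toReal)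
      ≤ ∫ y in (0 : ℝ)..(δ * M), C * Real.exp 1 / Real.sqrt M * y ^ (-(1 / 2) : ℝ) :=
        intervalIntegral.integral_mono_on_of_le_Ioo hδM hint
          ((intervalIntegral.intervalIntegrable_rpow' (by norm_num)).const_mul _) hpt
    _ = 2 * Real.exp 1 * 2 ^ d * (d.factorial : ℝ) * Real.sqrt δ := by
        rw [intervalIntegral.integral_const_mul, integral_rpow (Or.inl (by norm_num)),
          show (-(1 / 2) + 1 : ℝ) = 1 / 2 by norm_num, ← Real.sqrt_eq_rpow, ← Real.sqrt_eq_rpow,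
          Real.sqrt_zero, Real.sqrt_mul hδ0.le, hC]
        have hs0 : 0 < Real.sqrt M := Real.sqrt_pos.2 hM
        field_simp
        ring
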